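/- Let F : ℝ → ℝ be of class C¹ with F' < 0 everywhere, F(0) = 0, F(p) → +∞ as p → −∞ and F(p) → −∞ as p → +∞; let G be admissible for F, let E be a C¹ solution of E' = 1/G(−2F(E)) with E(0) = 0, let f : ℝ → ℝ be the C¹ function with f'(t) = −F(E(t)) and f(0)=0, and let g : ℝ → ℝ be a C¹ function with g(0) = 0, g'(0) = 0, g'(x) ≥ max(2x, ψ₁(x)) for x ≥ 0 and g'(x) ≤ min(2x, ψ₂(x)) for x ≤ 0, where ψ(t,x) = −F⁻¹(xE'(t) − F(E(t))) − E(t), ψ₁(x) = sup_{t∈ℝ} ψ(t,x), ψ₂(x) = inf_{t∈ℝ} ψ(t,x). Then the function φ(t,x) = f(t) + g(x) + xE(t) is of class C¹ and superlinear: φ(t,x)/|(t,x)| → +∞ as |(t,x)| → +∞. -/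

import Mathlib

open Set Filter Topology

/-- `F⁻¹`, the inverse of the decreasing bijection `F`. -/
noncomputable def Finv (F : ℝ → ℝ) : ℝ → ℝ := Function.invFun F

/-- `G` is admissible for `F`: it is continuous, even, dominates
`max((−F⁻¹)', (−2F)⁻¹) > 0`, non-increasing on `(-∞,0]` and non-decreasing on `[0,∞)`. -/
def Admissible (F G : ℝ → ℝ) : Prop :=
  Continuous G ∧
  (∀ x : ℝ, 0 < max (deriv (fun y => -(Finv F y)) x)
      (Function.invFun (fun p => -2 * F p) x)) ∧
  (∀ x : ℝ, max (deriv (fun y => -(Finv F y)) x)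
      (Function.invFun (fun p => -2 * F p) x) ≤ G x) ∧
  (∀ t : ℝ, G (-t) = G t) ∧
  AntitoneOn G (Iic 0) ∧ MonotoneOn G (Ici 0)

/-- `ψ(t,x) = −F⁻¹(x E'(t) − F(E(t))) − E(t)`. -/
noncomputable def psi (F E : ℝ → ℝ) (t x : ℝ) : ℝ :=
  -(Finv F (x * deriv E t - F (E t))) - E t

/-- `ψ₁(x) = sup_t ψ(t,x)` (in the extended reals). -/
noncomputable def psi1 (F E : ℝ → ℝ) (x : ℝ) : EReal :=
  ⨆ t : ℝ, (psi F E t x : EReal)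

/-- `ψ₂(x) = inf_t ψ(t,x)` (in the extended reals). -/
noncomputable def psi2 (F E : ℝ → ℝ) (x : ℝ) : EReal :=
  ⨅ t : ℝ, (psi F E t x : EReal)

theorem le_of_deriv_nonneg_Ici {h : ℝ → ℝ} (hh : Differentiable ℝ h) {a t : ℝ}
    (hd : ∀ s, a ≤ s → 0 ≤ deriv h s) (hat : a ≤ t) : h a ≤ h t := by
  refine monotoneOn_of_deriv_nonneg (convex_Ici a) hh.continuous.continuousOn
    hh.differentiableOn (fun s hs => ?_) (mem_Ici.2 le_rfl) (mem_Ici.2 hat) hat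
  rw [interior_Ici] at hs
  exact hd s (le_of_lt hs)

theorem apply_zero_le_of_deriv_sign {h : ℝ → ℝ} (hh : Differentiable ℝ h)
    (hpos : ∀ s, 0 ≤ s → 0 ≤ deriv h s) (hneg : ∀ s, s ≤ 0 → deriv h s ≤ 0) (t : ℝ) :
    h 0 ≤ h t := by
  rcases le_total 0 t with ht | ht
  · exact le_of_deriv_nonneg_Ici hh hpos ht
  · have := le_of_deriv_nonneg_Ici (h := fun s => h (-s)) (a := 0) (t := -t)
      (hh.comp differentiable_neg)
      (fun s hs => by
        rw [deriv_comp_neg]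
        have := hneg (-s) (by linarith)
        linarith) (by linarith)
    simpa using this

/-- Solutions of the autonomous equation `E' = 1 / H(E)` with `H > 0` escape to infinity. -/
theorem tendsto_atTop_of_deriv_eq_one_div {E H : ℝ → ℝ} (hE : Differentiable ℝ E)
    (hH : Continuous H) (hHpos : ∀ p, 0 < H p) (hE' : ∀ t, deriv E t = 1 / H (E t)) :
    Tendsto E atTop atTop := by
  have hpos : ∀ t, 0 < deriv E t := fun t => by
    rw [hE']; exact one_div_pos.2 (hHpos _)
  have hmono : Monotone E := (strictMono_of_deriv_pos hpos).monotone
  refine tendsto_atTop_atTop_of_monotone hmono fun b => ?_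
  by_contra! hb
  obtain ⟨K, hK⟩ := (isCompact_Icc (a := E 0) (b := b)).bddAbove_image hH.continuousOn
  have hKb : ∀ t, 0 ≤ t → H (E t) ≤ K := fun t ht =>
    hK ⟨E t, ⟨hmono ht, (hb t).le⟩, rfl⟩
  have hKpos : 0 < K := (hHpos _).trans_le (hKb 0 le_rfl)
  have hlin : ∀ t, 0 ≤ t → E 0 ≤ E t - 1 / K * t := fun t ht => by
    have hd : ∀ s, HasDerivAt (fun t => E t - 1 / K * t) (deriv E s - 1 / K) s := fun s => by
      simpa using (hE s).hasDerivAt.fun_sub ((hasDerivAt_id s).const_mul (1 / K))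
    have := le_of_deriv_nonneg_Ici (h := fun t => E t - 1 / K * t) (a := 0)
      (fun s => (hd s).differentiableAt) (fun s hs => by
        rw [(hd s).deriv, hE' s]
        exact sub_nonneg.2 (one_div_le_one_div_of_le (hHpos _) (hKb s hs))) ht
    simpa using this
  have h1 := hlin (K * (b - E 0)) (mul_nonneg hKpos.le (sub_nonneg.2 (hb 0).le))
  have h2 : 1 / K * (K * (b - E 0)) = b - E 0 := by field_simp
  have h3 := hb (K * (b - E 0))
  linarith

/-- A nonnegative function whose derivative tends to `+∞` grows faster than linearly. -/
theorem exists_linear_minorant {f : ℝ → ℝ} (hf : Differentiable ℝ f) (hf0 : ∀ t, 0 ≤ f t)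
    (hd : Tendsto (deriv f) atTop atTop) {M : ℝ} (hM : 0 ≤ M) :
    ∃ C, 0 ≤ C ∧ ∀ t, 0 ≤ t → M * t - C ≤ f t := by
  obtain ⟨T, hT0, hT⟩ := (tendsto_atTop_atTop.1 hd M).imp fun T hT =>
    (⟨le_max_right T 0, fun s hs => hT s ((le_max_left T 0).trans hs)⟩ :
      0 ≤ max T 0 ∧ ∀ s, max T 0 ≤ s → M ≤ deriv f s)
  set S := max T 0
  refine ⟨M * S, mul_nonneg hM hT0, fun t ht => ?_⟩
  rcases le_total t S with h | h
  · nlinarith [hf0 t]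
  · have hd : ∀ s, HasDerivAt (fun t => f t - M * t) (deriv f s - M) s := fun s => by
      simpa using (hf s).hasDerivAt.fun_sub ((hasDerivAt_id s).const_mul M)
    have := le_of_deriv_nonneg_Ici (h := fun t => f t - M * t)
      (fun s => (hd s).differentiableAt) (fun s hs => by
        rw [(hd s).deriv]
        exact sub_nonneg.2 (hT s hs)) h
    linarith [hf0 S]

/-- If `G` dominates `(-F⁻¹)'`, then `|p| ≤ |F p| · G(-2 F p)`, stated according to the sign
of `p`. -/
theorem le_mul_of_admissible {F G : ℝ → ℝ} (hF : ContDiff ℝ 1 F) (hF' : ∀ p, deriv F p < 0)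
    (hF0 : F 0 = 0) (hsurj : Function.Surjective F) (hG : Admissible F G) (p : ℝ) :
    (0 ≤ p → p ≤ -F p * G (-2 * F p)) ∧ (p ≤ 0 → -p ≤ F p * G (-2 * F p)) := by
  obtain ⟨-, -, hGle, hGe, -, hGm⟩ := hG
  have hanti : StrictAnti F := strictAnti_of_deriv_neg hF'
  have hleft : ∀ q, Finv F (F q) = q := Function.leftInverse_invFun hanti.injective
  have hdiff : Differentiable ℝ (fun y => -(Finv F y)) := fun y => by
    obtain ⟨q, rfl⟩ := hsurj y
    exact (((hF.contDiffAt.hasStrictDerivAt one_ne_zero).to_local_left_inverse (hF' q).ne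
      (Eventually.of_forall hleft)).hasDerivAt.differentiableAt).neg
  have h0 : Finv F 0 = 0 := by simpa [hF0] using hleft 0
  have hbound : ∀ y σ : ℝ, |y| ≤ |σ| → deriv (fun y => -(Finv F y)) y ≤ G (-2 * σ) := by
    intro y σ hy
    have habs : ∀ u, G |u| = G u := fun u => by
      rcases abs_choice u with h | h <;> rw [h]
      exact hGe u
    refine ((le_max_left _ _).trans (hGle y)).trans ?_
    rw [← habs y, ← habs (-2 * σ)]
    refine hGm (mem_Ici.2 (abs_nonneg _)) (mem_Ici.2 (abs_nonneg _)) ?_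
    rw [abs_mul, abs_neg, abs_two]
    linarith [abs_nonneg σ]
  constructor
  · intro hp
    have hFp : F p ≤ 0 := hF0 ▸ hanti.antitone hp
    have := (convex_Icc (F p) 0).image_sub_le_mul_sub_of_deriv_le
      hdiff.continuous.continuousOn hdiff.differentiableOn (C := G (-2 * F p))
      (fun y hy => by
        have hy := interior_subset hy
        exact hbound y _ (abs_le_abs_of_nonpos hy.2 hy.1)) _ (left_mem_Icc.2 hFp) _
      (right_mem_Icc.2 hFp) hFp
    simp only [h0, hleft] at this
    linarith
  · intro hp
    have hFp : 0 ≤ F p := hF0 ▸ hanti.antitone hp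
    have := (convex_Icc 0 (F p)).image_sub_le_mul_sub_of_deriv_le
      hdiff.continuous.continuousOn hdiff.differentiableOn (C := G (-2 * F p))
      (fun y hy => by
        have hy := interior_subset hy
        exact hbound y _ (abs_le_abs_of_nonneg hy.1 hy.2)) _ (left_mem_Icc.2 hFp) _
      (right_mem_Icc.2 hFp) hFp
    simp only [h0, hleft] at this
    linarith

/-- A function with affine minorants `M ‖z‖ - C` of every slope is superlinear. -/
theorem tendsto_div_norm_atTop {V : Type*} [NormedAddCommGroup V] [ProperSpace V] {φ : V → ℝ}
    (h : ∀ M : ℝ, 0 ≤ M → ∃ C, ∀ z, M * ‖z‖ - C ≤ φ z) :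
    Tendsto (fun z => φ z / ‖z‖) (cocompact V) atTop := by
  refine tendsto_atTop.2 fun b => ?_
  obtain ⟨C, hC⟩ := h (|b| + 1) (by positivity)
  filter_upwards [(tendsto_norm_cocompact_atTop (E := V)).eventually_ge_atTop (max C 1)] with z hz
  have h1 : C ≤ ‖z‖ := (le_max_left _ _).trans hz
  have h2 : 0 < ‖z‖ := one_pos.trans_le ((le_max_right _ _).trans hz)
  rw [le_div_iff₀ h2]
  nlinarith [hC z, le_abs_self b]

theorem stmt16 (F G E f g : ℝ → ℝ) (hF : ContDiff ℝ 1 F) (hF' : ∀ p, deriv F p < 0)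
    (hF0 : F 0 = 0) (hFbot : Tendsto F atBot atTop) (hFtop : Tendsto F atTop atBot)
    (hG : Admissible F G)
    (hE : ContDiff ℝ 1 E) (hE0 : E 0 = 0)
    (hE' : ∀ t : ℝ, deriv E t = 1 / G (-2 * F (E t)))
    (hf : ContDiff ℝ 1 f) (hf0 : f 0 = 0) (hf' : ∀ t : ℝ, deriv f t = -F (E t))
    (hg : ContDiff ℝ 1 g) (hg0 : g 0 = 0) (hg'0 : deriv g 0 = 0)
    (hg1 : ∀ x : ℝ, 0 ≤ x →
      max ((2 * x : ℝ) : EReal) (psi1 F E x) ≤ ((deriv g x : ℝ) : EReal))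
    (hg2 : ∀ x : ℝ, x ≤ 0 →
      ((deriv g x : ℝ) : EReal) ≤ min ((2 * x : ℝ) : EReal) (psi2 F E x)) :
    ContDiff ℝ 1 (fun z : ℝ × ℝ => f z.1 + g z.2 + z.2 * E z.1) ∧
    Tendsto (fun z : ℝ × ℝ => (f z.1 + g z.2 + z.2 * E z.1) / ‖z‖)
      (cocompact (ℝ × ℝ)) atTop := by
  refine ⟨((hf.comp contDiff_fst).add (hg.comp contDiff_snd)).add
    (contDiff_snd.mul (hE.comp contDiff_fst)), ?_⟩
  have hGpos : ∀ x, 0 < G x := fun x => (hG.2.1 x).trans_le (hG.2.2.1 x)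
  have hGc : Continuous G := hG.1
  have hsurj : Function.Surjective F := hF.continuous.surjective' hFbot hFtop
  have dE : Differentiable ℝ E := hE.differentiable one_ne_zero
  have df : Differentiable ℝ f := hf.differentiable one_ne_zero
  have dg : Differentiable ℝ g := hg.differentiable one_ne_zero
  have hH : Continuous fun p => G (-2 * F p) := hGc.comp (hF.continuous.const_mul _)
  have hEmono : Monotone E := (strictMono_of_deriv_pos fun t => by
    rw [hE']; exact one_div_pos.2 (hGpos _)).monotone
  have hEtop : Tendsto E atTop atTop :=
    tendsto_atTop_of_deriv_eq_one_div dE hH (fun p => hGpos _) hE'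
  have hEneg : Tendsto (fun t => -E (-t)) atTop atTop :=
    tendsto_atTop_of_deriv_eq_one_div (H := fun p => G (-2 * F (-p)))
      (dE.comp differentiable_neg).neg (hH.comp continuous_neg) (fun p => hGpos _) fun t => by
        have : deriv (fun t => -E (-t)) t = deriv E (-t) := by
          rw [deriv.fun_neg, deriv_comp_neg, neg_neg]
        rw [this, hE', neg_neg]
  have hfE : ∀ t, E t ^ 2 / 2 ≤ f t := fun t => by
    have hd : ∀ s, HasDerivAt (fun t => f t - E t ^ 2 / 2)
        (-F (E s) - E s / G (-2 * F (E s))) s := fun s => by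
      have h1 := (df s).hasDerivAt
      have h2 := (dE s).hasDerivAt
      rw [hf'] at h1
      rw [hE'] at h2
      refine (h1.fun_sub ((h2.fun_pow 2).div_const 2)).congr_deriv ?_
      push_cast
      ring
    have := apply_zero_le_of_deriv_sign (h := fun t => f t - E t ^ 2 / 2)
      (fun s => (hd s).differentiableAt)
      (fun s hs => by
        rw [(hd s).deriv, sub_nonneg, div_le_iff₀ (hGpos _)]
        exact (le_mul_of_admissible hF hF' hF0 hsurj hG (E s)).1 (hE0 ▸ hEmono hs))
      (fun s hs => by
        have := (le_mul_of_admissible hF hF' hF0 hsurj hG (E s)).2 (hE0 ▸ hEmono hs)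
        rw [(hd s).deriv, sub_nonpos, le_div_iff₀ (hGpos _)]
        linarith) t
    simp only [hf0, hE0] at this
    linarith
  have hgx : ∀ x, x ^ 2 ≤ g x := fun x => by
    have hd : ∀ s, HasDerivAt (fun t => g t - t ^ 2) (deriv g s - 2 * s) s := fun s => by
      simpa using (dg s).hasDerivAt.fun_sub (hasDerivAt_pow 2 s)
    have := apply_zero_le_of_deriv_sign (h := fun t => g t - t ^ 2)
      (fun s => (hd s).differentiableAt)
      (fun s hs => by
        rw [(hd s).deriv, sub_nonneg]
        exact EReal.coe_le_coe_iff.1 ((le_max_left _ _).trans (hg1 s hs)))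
      (fun s hs => by
        rw [(hd s).deriv, sub_nonpos]
        exact EReal.coe_le_coe_iff.1 ((hg2 s hs).trans (min_le_left _ _))) x
    simp only [hg0] at this
    linarith
  have hfpos : ∀ t, 0 ≤ f t := fun t => (by positivity : (0 : ℝ) ≤ E t ^ 2 / 2).trans (hfE t)
  have hftop : Tendsto (deriv f) atTop atTop := by
    rw [funext hf']
    exact tendsto_neg_atBot_atTop.comp (hFtop.comp hEtop)
  have hfbot : Tendsto (deriv fun t => f (-t)) atTop atTop := by
    have h : (deriv fun t => f (-t)) = fun t => F (- -E (-t)) := by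
      funext t
      rw [deriv_comp_neg, hf', neg_neg, neg_neg]
    rw [h]
    exact hFbot.comp (tendsto_neg_atTop_atBot.comp hEneg)
  refine tendsto_div_norm_atTop fun M hM => ?_
  obtain ⟨A, hA0, hA⟩ := exists_linear_minorant df hfpos hftop (M := 3 * M) (by positivity)
  obtain ⟨B, hB0, hB⟩ := exists_linear_minorant (f := fun t => f (-t))
    (df.comp differentiable_neg) (fun t => hfpos _) hfbot (M := 3 * M) (by positivity)
  refine ⟨A / 3 + B / 3 + M ^ 2, fun ⟨t, x⟩ => ?_⟩
  have ht : M * |t| - A / 3 - B / 3 ≤ f t / 3 := by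
    rcases le_total 0 t with h | h
    · rw [abs_of_nonneg h]
      linarith [hA t h]
    · have := hB (-t) (by linarith)
      rw [neg_neg] at this
      rw [abs_of_nonpos h]
      linarith
  have hx : M * |x| - M ^ 2 ≤ x ^ 2 / 4 := by
    nlinarith [sq_nonneg (|x| / 2 - M), sq_abs x]
  have hnorm : M * ‖(t, x)‖ ≤ M * |t| + M * |x| := by
    rw [← mul_add]
    refine mul_le_mul_of_nonneg_left ?_ hM
    rw [Prod.norm_def]
    exact max_le_add_of_nonneg (norm_nonneg _) (norm_nonneg _)
  have hcross : 0 ≤ 3 / 4 * x ^ 2 + E t ^ 2 / 3 + x * E t := by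
    nlinarith [sq_nonneg (3 * x + 2 * E t)]
  have h1 := hfE t
  have h2 := hgx x
  simp only
  linarith
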